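/- arXiv:2203.13045 — 2 statements merged into one kernel-verified Lean document; each statement's English description precedes it below -/
import Mathlib

section
/- (Conservation law ω₄ of the tangent equation.) Let (u,v) be a smooth solution of the Pavlov–Mikhalev system on ℝ³ and let (p,q) be a smooth solution of the tangent system. Set X₄ = y·(v_xx·p_t − v_xt·p_x + u_xx·q_t − u_xt·q_x + q_yt) − v_xy·p + v_x·p_y − u_xy·q + u_x·q_y − q_t and Y₄ = (u_x·v_xy + 2·v_y·u_xx − 2·v_x·u_xy − u_y·v_xx − v_xt)·p + (u_y·v_x − 2·u_x·v_y − 2·y·v_yt)·p_x + (u_x·v_x + y·v_xt)·p_y + (y·v_xy + v_x)·p_t + (u_x·u_xy − u_y·u_xx − u_xt)·q + (u_x·u_y + y·u_yt)·q_x − (u_x² + 2·y·u_xt)·q_y + (y·u_xy + u_x)·q_t + y·(2·v_x·p_yt − 2·v_y·p_xt + u_y·q_xt − u_x·q_yt + q_tt). Then ∂_y(X₄) = ∂_x(Y₄) at every point of ℝ³. -/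
noncomputable section

/-- Partial derivative with respect to the first coordinate `t`. -/
def Dt (f : ℝ → ℝ → ℝ → ℝ) : ℝ → ℝ → ℝ → ℝ := fun t x y => deriv (fun s => f s x y) t

/-- Partial derivative with respect to the second coordinate `x`. -/
def Dx (f : ℝ → ℝ → ℝ → ℝ) : ℝ → ℝ → ℝ → ℝ := fun t x y => deriv (fun s => f t s y) x

/-- Partial derivative with respect to the third coordinate `y`. -/
def Dy (f : ℝ → ℝ → ℝ → ℝ) : ℝ → ℝ → ℝ → ℝ := fun t x y => deriv (fun s => f t x s) y

/-- `f` is a smooth function on `ℝ³` (given in curried form, coordinates `(t, x, y)`). -/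
def Smooth3 (f : ℝ → ℝ → ℝ → ℝ) : Prop :=
  ContDiff ℝ (⊤ : ℕ∞) (fun p : ℝ × ℝ × ℝ => f p.1 p.2.1 p.2.2)

/-- The Pavlov–Mikhalev equation `u_yy = u_xt − u_x·u_xy + u_y·u_xx`. -/
def PMu (u : ℝ → ℝ → ℝ → ℝ) : Prop :=
  ∀ t x y : ℝ, Dy (Dy u) t x y =
    Dt (Dx u) t x y - Dx u t x y * Dy (Dx u) t x y + Dy u t x y * Dx (Dx u) t x y

/-- The second equation of the two-component Pavlov–Mikhalev system:
`v_yy = v_xt − u_x·v_xy − 2·v_y·u_xx + 2·v_x·u_xy + u_y·v_xx`. -/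
def PMv (u v : ℝ → ℝ → ℝ → ℝ) : Prop :=
  ∀ t x y : ℝ, Dy (Dy v) t x y =
    Dt (Dx v) t x y - Dx u t x y * Dy (Dx v) t x y
      - 2 * Dy v t x y * Dx (Dx u) t x y + 2 * Dx v t x y * Dy (Dx u) t x y
      + Dy u t x y * Dx (Dx v) t x y

/-- First equation of the linearized system applied to `A = φ^u`:
`φ^u_yy = φ^u_xt + u_xx·φ^u_y + u_y·φ^u_xx − u_x·φ^u_xy − u_xy·φ^u_x`. -/
def LinU (u A : ℝ → ℝ → ℝ → ℝ) : Prop :=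
  ∀ t x y : ℝ, Dy (Dy A) t x y =
    Dt (Dx A) t x y + Dx (Dx u) t x y * Dy A t x y + Dy u t x y * Dx (Dx A) t x y
      - Dx u t x y * Dy (Dx A) t x y - Dy (Dx u) t x y * Dx A t x y

/-- Second equation of the linearized system applied to `(A, B) = (φ^u, φ^v)`. -/
def LinV (u v A B : ℝ → ℝ → ℝ → ℝ) : Prop :=
  ∀ t x y : ℝ, Dy (Dy B) t x y =
    2 * Dx v t x y * Dy (Dx A) t x y - Dy (Dx v) t x y * Dx A t x y
      + Dx (Dx v) t x y * Dy A t x y - 2 * Dy v t x y * Dx (Dx A) t x y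
      + Dt (Dx B) t x y + 2 * Dy (Dx u) t x y * Dx B t x y
      - 2 * Dx (Dx u) t x y * Dy B t x y + Dy u t x y * Dx (Dx B) t x y
      - Dx u t x y * Dy (Dx B) t x y

/-- `(A,B)` is a symmetry generating function of the Pavlov–Mikhalev system over `(u,v)`. -/
def IsSymmetry (u v A B : ℝ → ℝ → ℝ → ℝ) : Prop := LinU u A ∧ LinV u v A B

/-- First equation of the tangent system over a solution `(u,v)`:
`p_yy = u_y·p_xx − u_xy·p_x − u_x·p_xy + u_xx·p_y + p_xt`. -/
def TanP (u p : ℝ → ℝ → ℝ → ℝ) : Prop :=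
  ∀ t x y : ℝ, Dy (Dy p) t x y =
    Dy u t x y * Dx (Dx p) t x y - Dy (Dx u) t x y * Dx p t x y
      - Dx u t x y * Dy (Dx p) t x y + Dx (Dx u) t x y * Dy p t x y + Dt (Dx p) t x y

/-- Second equation of the tangent system over a solution `(u,v)`:
`q_yy = 2·v_x·p_xy + v_xx·p_y − v_xy·p_x − 2·v_y·p_xx + 2·u_xy·q_x + u_y·q_xx
  − u_x·q_xy − 2·u_xx·q_y + q_xt`. -/
def TanQ (u v p q : ℝ → ℝ → ℝ → ℝ) : Prop :=
  ∀ t x y : ℝ, Dy (Dy q) t x y =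
    2 * Dx v t x y * Dy (Dx p) t x y + Dx (Dx v) t x y * Dy p t x y
      - Dy (Dx v) t x y * Dx p t x y - 2 * Dy v t x y * Dx (Dx p) t x y
      + 2 * Dy (Dx u) t x y * Dx q t x y + Dy u t x y * Dx (Dx q) t x y
      - Dx u t x y * Dy (Dx q) t x y - 2 * Dx (Dx u) t x y * Dy q t x y
      + Dt (Dx q) t x y


/-- The uncurried form of a function of three real variables. -/
def uncurry3 (f : ℝ → ℝ → ℝ → ℝ) : ℝ × ℝ × ℝ → ℝ := fun z => f z.1 z.2.1 z.2.2

theorem Smooth3.contDiff {f : ℝ → ℝ → ℝ → ℝ} (hf : Smooth3 f) :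
    ContDiff ℝ (⊤ : ℕ∞) (uncurry3 f) := hf

theorem Smooth3.differentiable {f : ℝ → ℝ → ℝ → ℝ} (hf : Smooth3 f) :
    Differentiable ℝ (uncurry3 f) := hf.contDiff.differentiable (by simp)

theorem Smooth3.hasDerivAt_t {f : ℝ → ℝ → ℝ → ℝ} (hf : Smooth3 f) (t x y : ℝ) :
    HasDerivAt (fun s => f s x y) (fderiv ℝ (uncurry3 f) (t, x, y) (1, 0, 0)) t :=
  (hf.differentiable (t, x, y)).hasFDerivAt.comp_hasDerivAt (f := fun s => (s, x, y)) t
    ((hasDerivAt_id t).prodMk ((hasDerivAt_const t x).prodMk (hasDerivAt_const t y)))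

theorem Smooth3.hasDerivAt_x {f : ℝ → ℝ → ℝ → ℝ} (hf : Smooth3 f) (t x y : ℝ) :
    HasDerivAt (fun s => f t s y) (fderiv ℝ (uncurry3 f) (t, x, y) (0, 1, 0)) x :=
  (hf.differentiable (t, x, y)).hasFDerivAt.comp_hasDerivAt (f := fun s => (t, s, y)) x
    ((hasDerivAt_const x t).prodMk ((hasDerivAt_id x).prodMk (hasDerivAt_const x y)))

theorem Smooth3.hasDerivAt_y {f : ℝ → ℝ → ℝ → ℝ} (hf : Smooth3 f) (t x y : ℝ) :
    HasDerivAt (fun s => f t x s) (fderiv ℝ (uncurry3 f) (t, x, y) (0, 0, 1)) y :=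
  (hf.differentiable (t, x, y)).hasFDerivAt.comp_hasDerivAt (f := fun s => (t, x, s)) y
    ((hasDerivAt_const y t).prodMk ((hasDerivAt_const y x).prodMk (hasDerivAt_id y)))

theorem Smooth3.uncurry3_Dt {f : ℝ → ℝ → ℝ → ℝ} (hf : Smooth3 f) :
    uncurry3 (Dt f) = fun z => fderiv ℝ (uncurry3 f) z (1, 0, 0) :=
  funext fun z => (hf.hasDerivAt_t z.1 z.2.1 z.2.2).deriv

theorem Smooth3.uncurry3_Dx {f : ℝ → ℝ → ℝ → ℝ} (hf : Smooth3 f) :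
    uncurry3 (Dx f) = fun z => fderiv ℝ (uncurry3 f) z (0, 1, 0) :=
  funext fun z => (hf.hasDerivAt_x z.1 z.2.1 z.2.2).deriv

theorem Smooth3.uncurry3_Dy {f : ℝ → ℝ → ℝ → ℝ} (hf : Smooth3 f) :
    uncurry3 (Dy f) = fun z => fderiv ℝ (uncurry3 f) z (0, 0, 1) :=
  funext fun z => (hf.hasDerivAt_y z.1 z.2.1 z.2.2).deriv

theorem contDiff_fderiv_apply_const {E : Type*} [NormedAddCommGroup E] [NormedSpace ℝ E]
    {F : E → ℝ} (hF : ContDiff ℝ (⊤ : ℕ∞) F) (e : E) :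
    ContDiff ℝ (⊤ : ℕ∞) (fun z => fderiv ℝ F z e) :=
  (hF.fderiv_right (m := (⊤ : ℕ∞)) (by simp)).clm_apply contDiff_const

theorem fderiv_fderiv_apply_comm {E : Type*} [NormedAddCommGroup E] [NormedSpace ℝ E]
    {F : E → ℝ} (hF : ContDiff ℝ (⊤ : ℕ∞) F) (a b z : E) :
    fderiv ℝ (fun w => fderiv ℝ F w a) z b = fderiv ℝ (fun w => fderiv ℝ F w b) z a := by
  have hd : DifferentiableAt ℝ (fderiv ℝ F) z :=
    (hF.fderiv_right (m := (⊤ : ℕ∞)) (by simp)).differentiable (by simp) z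
  have hsymm : IsSymmSndFDerivAt ℝ F z :=
    hF.contDiffAt.isSymmSndFDerivAt (by simp; exact WithTop.coe_le_coe.2 le_top)
  rw [fderiv_clm_apply hd (differentiableAt_const a), fderiv_clm_apply hd (differentiableAt_const b)]
  simpa using hsymm b a

theorem Smooth3.dt {f : ℝ → ℝ → ℝ → ℝ} (hf : Smooth3 f) : Smooth3 (Dt f) := by
  change ContDiff ℝ _ (uncurry3 (Dt f))
  exact hf.uncurry3_Dt ▸ contDiff_fderiv_apply_const hf.contDiff _

theorem Smooth3.dx {f : ℝ → ℝ → ℝ → ℝ} (hf : Smooth3 f) : Smooth3 (Dx f) := by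
  change ContDiff ℝ _ (uncurry3 (Dx f))
  exact hf.uncurry3_Dx ▸ contDiff_fderiv_apply_const hf.contDiff _

theorem Smooth3.dy {f : ℝ → ℝ → ℝ → ℝ} (hf : Smooth3 f) : Smooth3 (Dy f) := by
  change ContDiff ℝ _ (uncurry3 (Dy f))
  exact hf.uncurry3_Dy ▸ contDiff_fderiv_apply_const hf.contDiff _

theorem Smooth3.Dx_Dt {f : ℝ → ℝ → ℝ → ℝ} (hf : Smooth3 f) : Dx (Dt f) = Dt (Dx f) := by
  ext t x y
  refine (hf.dt.hasDerivAt_x t x y).deriv.trans (.trans ?_ (hf.dx.hasDerivAt_t t x y).deriv.symm)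
  rw [hf.uncurry3_Dt, hf.uncurry3_Dx]
  exact fderiv_fderiv_apply_comm hf.contDiff _ _ _

theorem Smooth3.Dy_Dt {f : ℝ → ℝ → ℝ → ℝ} (hf : Smooth3 f) : Dy (Dt f) = Dt (Dy f) := by
  ext t x y
  refine (hf.dt.hasDerivAt_y t x y).deriv.trans (.trans ?_ (hf.dy.hasDerivAt_t t x y).deriv.symm)
  rw [hf.uncurry3_Dt, hf.uncurry3_Dy]
  exact fderiv_fderiv_apply_comm hf.contDiff _ _ _

theorem Smooth3.Dx_Dy {f : ℝ → ℝ → ℝ → ℝ} (hf : Smooth3 f) : Dx (Dy f) = Dy (Dx f) := by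
  ext t x y
  refine (hf.dy.hasDerivAt_x t x y).deriv.trans (.trans ?_ (hf.dx.hasDerivAt_y t x y).deriv.symm)
  rw [hf.uncurry3_Dy, hf.uncurry3_Dx]
  exact fderiv_fderiv_apply_comm hf.contDiff _ _ _

theorem smooth3_const (c : ℝ) : Smooth3 (fun _ _ _ => c) :=
  show ContDiff ℝ _ (fun _ : ℝ × ℝ × ℝ => c) from contDiff_const

theorem smooth3_two : Smooth3 2 := smooth3_const 2

theorem smooth3_snd_snd : Smooth3 (fun _ _ y => y) :=
  show ContDiff ℝ _ (fun z : ℝ × ℝ × ℝ => z.2.2) from contDiff_snd.comp contDiff_snd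

theorem Smooth3.add {f g : ℝ → ℝ → ℝ → ℝ} (hf : Smooth3 f) (hg : Smooth3 g) : Smooth3 (f + g) :=
  ContDiff.add hf hg

theorem Smooth3.sub {f g : ℝ → ℝ → ℝ → ℝ} (hf : Smooth3 f) (hg : Smooth3 g) : Smooth3 (f - g) :=
  ContDiff.sub hf hg

theorem Smooth3.mul {f g : ℝ → ℝ → ℝ → ℝ} (hf : Smooth3 f) (hg : Smooth3 g) : Smooth3 (f * g) :=
  ContDiff.mul hf hg

section Leibniz

variable {f g : ℝ → ℝ → ℝ → ℝ}

theorem Dt_add (hf : Smooth3 f) (hg : Smooth3 g) : Dt (f + g) = Dt f + Dt g := by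
  ext t x y
  exact deriv_fun_add (hf.hasDerivAt_t t x y).differentiableAt
    (hg.hasDerivAt_t t x y).differentiableAt

theorem Dt_sub (hf : Smooth3 f) (hg : Smooth3 g) : Dt (f - g) = Dt f - Dt g := by
  ext t x y
  exact deriv_fun_sub (hf.hasDerivAt_t t x y).differentiableAt
    (hg.hasDerivAt_t t x y).differentiableAt

theorem Dt_mul (hf : Smooth3 f) (hg : Smooth3 g) : Dt (f * g) = Dt f * g + f * Dt g := by
  ext t x y
  exact deriv_fun_mul (hf.hasDerivAt_t t x y).differentiableAt
    (hg.hasDerivAt_t t x y).differentiableAt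

theorem Dx_add (hf : Smooth3 f) (hg : Smooth3 g) : Dx (f + g) = Dx f + Dx g := by
  ext t x y
  exact deriv_fun_add (hf.hasDerivAt_x t x y).differentiableAt
    (hg.hasDerivAt_x t x y).differentiableAt

theorem Dx_sub (hf : Smooth3 f) (hg : Smooth3 g) : Dx (f - g) = Dx f - Dx g := by
  ext t x y
  exact deriv_fun_sub (hf.hasDerivAt_x t x y).differentiableAt
    (hg.hasDerivAt_x t x y).differentiableAt

theorem Dx_mul (hf : Smooth3 f) (hg : Smooth3 g) : Dx (f * g) = Dx f * g + f * Dx g := by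
  ext t x y
  exact deriv_fun_mul (hf.hasDerivAt_x t x y).differentiableAt
    (hg.hasDerivAt_x t x y).differentiableAt

theorem Dy_add (hf : Smooth3 f) (hg : Smooth3 g) : Dy (f + g) = Dy f + Dy g := by
  ext t x y
  exact deriv_fun_add (hf.hasDerivAt_y t x y).differentiableAt
    (hg.hasDerivAt_y t x y).differentiableAt

theorem Dy_sub (hf : Smooth3 f) (hg : Smooth3 g) : Dy (f - g) = Dy f - Dy g := by
  ext t x y
  exact deriv_fun_sub (hf.hasDerivAt_y t x y).differentiableAt
    (hg.hasDerivAt_y t x y).differentiableAt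

theorem Dy_mul (hf : Smooth3 f) (hg : Smooth3 g) : Dy (f * g) = Dy f * g + f * Dy g := by
  ext t x y
  exact deriv_fun_mul (hf.hasDerivAt_y t x y).differentiableAt
    (hg.hasDerivAt_y t x y).differentiableAt

end Leibniz

theorem Dt_two : Dt 2 = 0 := by ext t x y; exact deriv_const t (2 : ℝ)

theorem Dx_two : Dx 2 = 0 := by ext t x y; exact deriv_const x (2 : ℝ)

theorem Dx_snd_snd : Dx (fun _ _ y => y) = 0 := by ext t x y; exact deriv_const x y

theorem Dy_snd_snd : Dy (fun _ _ y => y) = 1 := by ext t x y; exact deriv_id y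

theorem conservation_law_omega4 (u v p q : ℝ → ℝ → ℝ → ℝ)
    (hu : Smooth3 u) (hv : Smooth3 v) (hp : Smooth3 p) (hq : Smooth3 q)
    (hPMu : PMu u) (hPMv : PMv u v) (hTanP : TanP u p) (hTanQ : TanQ u v p q)
    (X₄ Y₄ : ℝ → ℝ → ℝ → ℝ)
    (hX : X₄ = fun t x y => y * (Dx (Dx v) t x y * Dt p t x y - Dt (Dx v) t x y * Dx p t x y
        + Dx (Dx u) t x y * Dt q t x y - Dt (Dx u) t x y * Dx q t x y + Dt (Dy q) t x y)
      - Dy (Dx v) t x y * p t x y + Dx v t x y * Dy p t x y - Dy (Dx u) t x y * q t x y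
      + Dx u t x y * Dy q t x y - Dt q t x y)
    (hY : Y₄ = fun t x y => (Dx u t x y * Dy (Dx v) t x y + 2 * Dy v t x y * Dx (Dx u) t x y
        - 2 * Dx v t x y * Dy (Dx u) t x y - Dy u t x y * Dx (Dx v) t x y
        - Dt (Dx v) t x y) * p t x y
      + (Dy u t x y * Dx v t x y - 2 * Dx u t x y * Dy v t x y
        - 2 * y * Dt (Dy v) t x y) * Dx p t x y
      + (Dx u t x y * Dx v t x y + y * Dt (Dx v) t x y) * Dy p t x y
      + (y * Dy (Dx v) t x y + Dx v t x y) * Dt p t x y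
      + (Dx u t x y * Dy (Dx u) t x y - Dy u t x y * Dx (Dx u) t x y
        - Dt (Dx u) t x y) * q t x y
      + (Dx u t x y * Dy u t x y + y * Dt (Dy u) t x y) * Dx q t x y
      - ((Dx u t x y)^2 + 2 * y * Dt (Dx u) t x y) * Dy q t x y
      + (y * Dy (Dx u) t x y + Dx u t x y) * Dt q t x y
      + y * (2 * Dx v t x y * Dt (Dy p) t x y - 2 * Dy v t x y * Dt (Dx p) t x y
        + Dy u t x y * Dt (Dx q) t x y - Dx u t x y * Dt (Dy q) t x y
        + Dt (Dt q) t x y)) :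
    ∀ t x y : ℝ, Dy X₄ t x y = Dx Y₄ t x y := by
  have hPMu' : Dy (Dy u) = Dt (Dx u) - Dx u * Dy (Dx u) + Dy u * Dx (Dx u) := by
    ext t x y; exact hPMu t x y
  have hPMv' : Dy (Dy v) = Dt (Dx v) - Dx u * Dy (Dx v) - 2 * Dy v * Dx (Dx u)
      + 2 * Dx v * Dy (Dx u) + Dy u * Dx (Dx v) := by
    ext t x y; exact hPMv t x y
  have hTanQ' : Dy (Dy q) = 2 * Dx v * Dy (Dx p) + Dx (Dx v) * Dy p
      - Dy (Dx v) * Dx p - 2 * Dy v * Dx (Dx p) + 2 * Dy (Dx u) * Dx q + Dy u * Dx (Dx q)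
      - Dx u * Dy (Dx q) - 2 * Dx (Dx u) * Dy q + Dt (Dx q) := by
    ext t x y; exact hTanQ t x y
  obtain ⟨Y, hYv, sY, dxY, dyY⟩ : ∃ Y : ℝ → ℝ → ℝ → ℝ, (∀ t x y, Y t x y = y) ∧ Smooth3 Y ∧
      Dx Y = 0 ∧ Dy Y = 1 :=
    ⟨fun _ _ y => y, fun _ _ _ => rfl, smooth3_snd_snd, Dx_snd_snd, Dy_snd_snd⟩
  have hX' : X₄ = Y * (Dx (Dx v) * Dt p - Dt (Dx v) * Dx p + Dx (Dx u) * Dt q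
      - Dt (Dx u) * Dx q + Dt (Dy q))
      - Dy (Dx v) * p + Dx v * Dy p - Dy (Dx u) * q + Dx u * Dy q - Dt q := by
    ext t x y; simp [hX, hYv]
  have hY' : Y₄ = (Dx u * Dy (Dx v) + 2 * Dy v * Dx (Dx u) - 2 * Dx v * Dy (Dx u)
        - Dy u * Dx (Dx v) - Dt (Dx v)) * p
      + (Dy u * Dx v - 2 * Dx u * Dy v - 2 * Y * Dt (Dy v)) * Dx p
      + (Dx u * Dx v + Y * Dt (Dx v)) * Dy p
      + (Y * Dy (Dx v) + Dx v) * Dt p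
      + (Dx u * Dy (Dx u) - Dy u * Dx (Dx u) - Dt (Dx u)) * q
      + (Dx u * Dy u + Y * Dt (Dy u)) * Dx q
      - (Dx u * Dx u + 2 * Y * Dt (Dx u)) * Dy q
      + (Y * Dy (Dx u) + Dx u) * Dt q
      + Y * (2 * Dx v * Dt (Dy p) - 2 * Dy v * Dt (Dx p) + Dy u * Dt (Dx q)
        - Dx u * Dt (Dy q) + Dt (Dt q)) := by
    ext t x y; simp [hY, hYv, sq]
  have hPMu_x := congrArg Dx hPMu'
  have hPMv_x := congrArg Dx hPMv'
  have hTanQ_t := congrArg Dt hTanQ'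
  simp (maxDischargeDepth := 20) only [Dx_add, Dx_sub, Dx_mul, Dt_add, Dt_sub, Dt_mul,
    Dx_two, Dt_two, Smooth3.Dx_Dt, Smooth3.Dx_Dy, Smooth3.dt, Smooth3.dx, Smooth3.dy, Smooth3.add, Smooth3.sub, Smooth3.mul,
    smooth3_two, hu, hv, hp, hq] at hPMu_x hPMv_x hTanQ_t
  intro t x y
  rw [hX', hY']
  simp (maxDischargeDepth := 20) only [Dx_add, Dx_sub, Dx_mul, Dy_add, Dy_sub, Dy_mul,
    Dx_two, dxY, dyY, Smooth3.Dx_Dt, Smooth3.Dx_Dy, Smooth3.Dy_Dt, Smooth3.dt, Smooth3.dx, Smooth3.dy, Smooth3.add, Smooth3.sub,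
    Smooth3.mul, smooth3_two, sY, hu, hv, hp, hq]
  rw [hPMu_x, hPMv_x, hTanQ_t, hTanQ']
  simp only [Pi.add_apply, Pi.sub_apply, Pi.mul_apply, Pi.ofNat_apply, hYv, hTanP t x y]
  ring
end
end

section
/- (Triviality of the conservation law ω₆: an off-shell identity.) For all smooth functions u, v, p, q : ℝ³ → ℝ (no equations imposed), set X₆ = v_xx·p_t − v_xt·p_x + u_xx·q_t − u_xt·q_x + q_yt, Y₆ = v_xy·p_t − 2·v_yt·p_x − 2·v_y·p_xt + v_xt·p_y + 2·v_x·p_yt + u_xy·q_t + u_yt·q_x + u_y·q_xt − 2·u_xt·q_y − u_x·q_yt + q_tt, and F_q = q_yy − 2·v_x·p_xy − v_xx·p_y + v_xy·p_x + 2·v_y·p_xx − 2·u_xy·q_x − u_y·q_xx + u_x·q_xy + 2·u_xx·q_y − q_xt. Then the identity ∂_y(X₆) − ∂_x(Y₆) = ∂_t(F_q) holds at every point of ℝ³. (Hence the generating section of ω₆ vanishes and ω₆ is a trivial conservation law on J^∞, although the associated covering is nontrivial.) -/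
noncomputable section

namespace Smooth3

/-- The uncurried form of a function of three variables. -/
def uncurry (f : ℝ → ℝ → ℝ → ℝ) : ℝ × ℝ × ℝ → ℝ := fun p => f p.1 p.2.1 p.2.2

variable {f : ℝ → ℝ → ℝ → ℝ}

lemma hasFDerivAt (hf : Smooth3 f) (p : ℝ × ℝ × ℝ) :
    HasFDerivAt (uncurry f) (fderiv ℝ (uncurry f) p) p :=
  (ContDiff.differentiable (f := uncurry f) hf (by simp) p).hasFDerivAt

lemma hasDerivAt_t_fderiv (hf : Smooth3 f) (t x y : ℝ) :
    HasDerivAt (fun s => f s x y) (fderiv ℝ (uncurry f) (t, x, y) (1, 0, 0)) t :=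
  (hf.hasFDerivAt (t, x, y)).comp_hasDerivAt (f := fun s : ℝ => (s, x, y)) t
    ((hasDerivAt_id t).prodMk ((hasDerivAt_const t x).prodMk (hasDerivAt_const t y)))

lemma hasDerivAt_x_fderiv (hf : Smooth3 f) (t x y : ℝ) :
    HasDerivAt (fun s => f t s y) (fderiv ℝ (uncurry f) (t, x, y) (0, 1, 0)) x :=
  (hf.hasFDerivAt (t, x, y)).comp_hasDerivAt (f := fun s : ℝ => (t, s, y)) x
    ((hasDerivAt_const x t).prodMk ((hasDerivAt_id x).prodMk (hasDerivAt_const x y)))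

lemma hasDerivAt_y_fderiv (hf : Smooth3 f) (t x y : ℝ) :
    HasDerivAt (fun s => f t x s) (fderiv ℝ (uncurry f) (t, x, y) (0, 0, 1)) y :=
  (hf.hasFDerivAt (t, x, y)).comp_hasDerivAt (f := fun s : ℝ => (t, x, s)) y
    ((hasDerivAt_const y t).prodMk ((hasDerivAt_const y x).prodMk (hasDerivAt_id y)))

lemma hasDerivAt_t_s17 (hf : Smooth3 f) (t x y : ℝ) :
    HasDerivAt (fun s => f s x y) (Dt f t x y) t :=
  (hf.hasDerivAt_t_fderiv t x y).differentiableAt.hasDerivAt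

lemma hasDerivAt_x_s17 (hf : Smooth3 f) (t x y : ℝ) :
    HasDerivAt (fun s => f t s y) (Dx f t x y) x :=
  (hf.hasDerivAt_x_fderiv t x y).differentiableAt.hasDerivAt

lemma hasDerivAt_y_s17 (hf : Smooth3 f) (t x y : ℝ) :
    HasDerivAt (fun s => f t x s) (Dy f t x y) y :=
  (hf.hasDerivAt_y_fderiv t x y).differentiableAt.hasDerivAt

lemma uncurry_Dt (hf : Smooth3 f) :
    uncurry (Dt f) = fun p => fderiv ℝ (uncurry f) p (1, 0, 0) :=
  funext fun p => (hf.hasDerivAt_t_fderiv p.1 p.2.1 p.2.2).deriv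

lemma uncurry_Dx (hf : Smooth3 f) :
    uncurry (Dx f) = fun p => fderiv ℝ (uncurry f) p (0, 1, 0) :=
  funext fun p => (hf.hasDerivAt_x_fderiv p.1 p.2.1 p.2.2).deriv

lemma uncurry_Dy (hf : Smooth3 f) :
    uncurry (Dy f) = fun p => fderiv ℝ (uncurry f) p (0, 0, 1) :=
  funext fun p => (hf.hasDerivAt_y_fderiv p.1 p.2.1 p.2.2).deriv

lemma contDiff_fderiv (hf : Smooth3 f) : ContDiff ℝ (⊤ : ℕ∞) (fderiv ℝ (uncurry f)) :=
  ContDiff.fderiv_right (f := uncurry f) hf (by simp)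

lemma dt_s17 (hf : Smooth3 f) : Smooth3 (Dt f) := by
  change ContDiff ℝ (⊤ : ℕ∞) (uncurry (Dt f))
  rw [hf.uncurry_Dt]
  exact hf.contDiff_fderiv.clm_apply contDiff_const

lemma dx_s17 (hf : Smooth3 f) : Smooth3 (Dx f) := by
  change ContDiff ℝ (⊤ : ℕ∞) (uncurry (Dx f))
  rw [hf.uncurry_Dx]
  exact hf.contDiff_fderiv.clm_apply contDiff_const

lemma dy_s17 (hf : Smooth3 f) : Smooth3 (Dy f) := by
  change ContDiff ℝ (⊤ : ℕ∞) (uncurry (Dy f))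
  rw [hf.uncurry_Dy]
  exact hf.contDiff_fderiv.clm_apply contDiff_const

lemma fderiv_fderiv_apply_comm (hf : Smooth3 f) (p a b : ℝ × ℝ × ℝ) :
    fderiv ℝ (fun z => fderiv ℝ (uncurry f) z a) p b =
      fderiv ℝ (fun z => fderiv ℝ (uncurry f) z b) p a := by
  have hd : DifferentiableAt ℝ (fderiv ℝ (uncurry f)) p :=
    hf.contDiff_fderiv.differentiable (by simp) p
  have hs : IsSymmSndFDerivAt ℝ (uncurry f) p :=
    (ContDiff.contDiffAt (f := uncurry f) hf).isSymmSndFDerivAt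
      (by rw [minSmoothness_of_isRCLikeNormedField]
          exact WithTop.coe_le_coe.2 (le_top : (2 : ℕ∞) ≤ ⊤))
  rw [fderiv_clm_apply hd (differentiableAt_const a),
    fderiv_clm_apply hd (differentiableAt_const b)]
  simpa using hs b a

lemma Dx_Dt_s17 (hf : Smooth3 f) : Dx (Dt f) = Dt (Dx f) := by
  funext t x y
  rw [Dx, (hf.dt_s17.hasDerivAt_x_fderiv t x y).deriv, Dt,
    (hf.dx_s17.hasDerivAt_t_fderiv t x y).deriv, hf.uncurry_Dt, hf.uncurry_Dx]
  exact hf.fderiv_fderiv_apply_comm _ _ _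

lemma Dy_Dt_s17 (hf : Smooth3 f) : Dy (Dt f) = Dt (Dy f) := by
  funext t x y
  rw [Dy, (hf.dt_s17.hasDerivAt_y_fderiv t x y).deriv, Dt,
    (hf.dy_s17.hasDerivAt_t_fderiv t x y).deriv, hf.uncurry_Dt, hf.uncurry_Dy]
  exact hf.fderiv_fderiv_apply_comm _ _ _

lemma Dx_Dy_s17 (hf : Smooth3 f) : Dx (Dy f) = Dy (Dx f) := by
  funext t x y
  rw [Dx, (hf.dy_s17.hasDerivAt_x_fderiv t x y).deriv, Dy,
    (hf.dx_s17.hasDerivAt_y_fderiv t x y).deriv, hf.uncurry_Dy, hf.uncurry_Dx]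
  exact hf.fderiv_fderiv_apply_comm _ _ _

end Smooth3

theorem omega6_trivial (u v p q : ℝ → ℝ → ℝ → ℝ)
    (hu : Smooth3 u) (hv : Smooth3 v) (hp : Smooth3 p) (hq : Smooth3 q)
    (X₆ Y₆ Fq : ℝ → ℝ → ℝ → ℝ)
    (hX : X₆ = fun t x y => Dx (Dx v) t x y * Dt p t x y - Dt (Dx v) t x y * Dx p t x y
      + Dx (Dx u) t x y * Dt q t x y - Dt (Dx u) t x y * Dx q t x y + Dt (Dy q) t x y)
    (hY : Y₆ = fun t x y => Dy (Dx v) t x y * Dt p t x y - 2 * Dt (Dy v) t x y * Dx p t x y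
      - 2 * Dy v t x y * Dt (Dx p) t x y + Dt (Dx v) t x y * Dy p t x y
      + 2 * Dx v t x y * Dt (Dy p) t x y + Dy (Dx u) t x y * Dt q t x y
      + Dt (Dy u) t x y * Dx q t x y + Dy u t x y * Dt (Dx q) t x y
      - 2 * Dt (Dx u) t x y * Dy q t x y - Dx u t x y * Dt (Dy q) t x y
      + Dt (Dt q) t x y)
    (hF : Fq = fun t x y => Dy (Dy q) t x y - 2 * Dx v t x y * Dy (Dx p) t x y
      - Dx (Dx v) t x y * Dy p t x y + Dy (Dx v) t x y * Dx p t x y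
      + 2 * Dy v t x y * Dx (Dx p) t x y - 2 * Dy (Dx u) t x y * Dx q t x y
      - Dy u t x y * Dx (Dx q) t x y + Dx u t x y * Dy (Dx q) t x y
      + 2 * Dx (Dx u) t x y * Dy q t x y - Dt (Dx q) t x y) :
    ∀ t x y : ℝ, Dy X₆ t x y - Dx Y₆ t x y = Dt Fq t x y := by
  subst hX hY hF
  intro t x y
  have hX := HasDerivAt.deriv <|
    (((((hv.dx_s17.dx_s17.hasDerivAt_y_s17 t x y).fun_mul (hp.dt_s17.hasDerivAt_y_s17 t x y)).fun_sub
      ((hv.dx_s17.dt_s17.hasDerivAt_y_s17 t x y).fun_mul (hp.dx_s17.hasDerivAt_y_s17 t x y))).fun_add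
      ((hu.dx_s17.dx_s17.hasDerivAt_y_s17 t x y).fun_mul (hq.dt_s17.hasDerivAt_y_s17 t x y))).fun_sub
      ((hu.dx_s17.dt_s17.hasDerivAt_y_s17 t x y).fun_mul (hq.dx_s17.hasDerivAt_y_s17 t x y))).fun_add
      (hq.dy_s17.dt_s17.hasDerivAt_y_s17 t x y)
  have hY := HasDerivAt.deriv <|
    (((((((((((hv.dx_s17.dy_s17.hasDerivAt_x_s17 t x y).fun_mul (hp.dt_s17.hasDerivAt_x_s17 t x y)).fun_sub
      (((hv.dy_s17.dt_s17.hasDerivAt_x_s17 t x y).const_mul 2).fun_mul (hp.dx_s17.hasDerivAt_x_s17 t x y))).fun_sub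
      (((hv.dy_s17.hasDerivAt_x_s17 t x y).const_mul 2).fun_mul (hp.dx_s17.dt_s17.hasDerivAt_x_s17 t x y))).fun_add
      ((hv.dx_s17.dt_s17.hasDerivAt_x_s17 t x y).fun_mul (hp.dy_s17.hasDerivAt_x_s17 t x y))).fun_add
      (((hv.dx_s17.hasDerivAt_x_s17 t x y).const_mul 2).fun_mul (hp.dy_s17.dt_s17.hasDerivAt_x_s17 t x y))).fun_add
      ((hu.dx_s17.dy_s17.hasDerivAt_x_s17 t x y).fun_mul (hq.dt_s17.hasDerivAt_x_s17 t x y))).fun_add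
      ((hu.dy_s17.dt_s17.hasDerivAt_x_s17 t x y).fun_mul (hq.dx_s17.hasDerivAt_x_s17 t x y))).fun_add
      ((hu.dy_s17.hasDerivAt_x_s17 t x y).fun_mul (hq.dx_s17.dt_s17.hasDerivAt_x_s17 t x y))).fun_sub
      (((hu.dx_s17.dt_s17.hasDerivAt_x_s17 t x y).const_mul 2).fun_mul (hq.dy_s17.hasDerivAt_x_s17 t x y))).fun_sub
      ((hu.dx_s17.hasDerivAt_x_s17 t x y).fun_mul (hq.dy_s17.dt_s17.hasDerivAt_x_s17 t x y))).fun_add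
      (hq.dt_s17.dt_s17.hasDerivAt_x_s17 t x y)
  have hF := HasDerivAt.deriv <|
    (((((((((hq.dy_s17.dy_s17.hasDerivAt_t_s17 t x y).fun_sub
      (((hv.dx_s17.hasDerivAt_t_s17 t x y).const_mul 2).fun_mul (hp.dx_s17.dy_s17.hasDerivAt_t_s17 t x y))).fun_sub
      ((hv.dx_s17.dx_s17.hasDerivAt_t_s17 t x y).fun_mul (hp.dy_s17.hasDerivAt_t_s17 t x y))).fun_add
      ((hv.dx_s17.dy_s17.hasDerivAt_t_s17 t x y).fun_mul (hp.dx_s17.hasDerivAt_t_s17 t x y))).fun_add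
      (((hv.dy_s17.hasDerivAt_t_s17 t x y).const_mul 2).fun_mul (hp.dx_s17.dx_s17.hasDerivAt_t_s17 t x y))).fun_sub
      (((hu.dx_s17.dy_s17.hasDerivAt_t_s17 t x y).const_mul 2).fun_mul (hq.dx_s17.hasDerivAt_t_s17 t x y))).fun_sub
      ((hu.dy_s17.hasDerivAt_t_s17 t x y).fun_mul (hq.dx_s17.dx_s17.hasDerivAt_t_s17 t x y))).fun_add
      ((hu.dx_s17.hasDerivAt_t_s17 t x y).fun_mul (hq.dx_s17.dy_s17.hasDerivAt_t_s17 t x y))).fun_add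
      (((hu.dx_s17.dx_s17.hasDerivAt_t_s17 t x y).const_mul 2).fun_mul (hq.dy_s17.hasDerivAt_t_s17 t x y))).fun_sub
      (hq.dx_s17.dt_s17.hasDerivAt_t_s17 t x y)
  change deriv _ y - deriv _ x = deriv _ t
  rw [hX, hY, hF]
  simp only [hu.Dx_Dy_s17, hu.dx_s17.Dx_Dt_s17, hu.dx_s17.Dy_Dt_s17, hu.dx_s17.Dx_Dy_s17, hu.dy_s17.Dx_Dt_s17, hv.Dx_Dy_s17, hv.dx_s17.Dx_Dt_s17,
    hv.dx_s17.Dy_Dt_s17, hv.dx_s17.Dx_Dy_s17, hv.dy_s17.Dx_Dt_s17, hp.Dx_Dt_s17, hp.Dy_Dt_s17, hp.Dx_Dy_s17, hp.dx_s17.Dx_Dt_s17,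
    hp.dy_s17.Dx_Dt_s17, hq.Dx_Dt_s17, hq.Dy_Dt_s17, hq.Dx_Dy_s17, hq.dx_s17.Dx_Dt_s17, hq.dy_s17.Dx_Dt_s17, hq.dy_s17.Dy_Dt_s17,
    hq.dt_s17.Dx_Dt_s17]
  ring
end
end
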